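/- Let ω = (ω₁, ω₂) be irrational. Let I be a finite set, a, b : I → ℤ with the map i ↦ (a_i, b_i) injective, and set Λ₁ := {(a_i, b_i) : i ∈ I} ⊆ ℤ². Let Λ₂ ⊆ ℤ² be finite. Suppose: (existence and uniqueness of spouse and children) for every n₁ ∈ Λ₁ there exist n₂ ∈ Λ₁ and n₃, n₄ ∈ Λ₂ such that (n₁, n₂, n₃, n₄) is a nondegenerate element of R, and whenever n₂′ ∈ Λ₁ and n₃′, n₄′ ∈ Λ₂ are such that (n₁, n₂′, n₃′, n₄′) is a nondegenerate element of R, one has n₂′ = n₂ and {n₃′, n₄′} = {n₃, n₄}; (existence and uniqueness of sibling and parents) for every n₃ ∈ Λ₂ there exist n₄ ∈ Λ₂ and n₁, n₂ ∈ Λ₁ such that (n₁, n₂, n₃, n₄) is a nondegenerate element of R, and whenever n₄′ ∈ Λ₂ and n₁′, n₂′ ∈ Λ₁ are such that (n₁′, n₂′, n₃, n₄′) is a nondegenerate element of R, one has n₄′ = n₄ and {n₁′, n₂′} = {n₁, n₂}. Then there exists a bijection σ : I → I such that Λ₂ = {(a_i, b_{σ(i)}) : i ∈ I}. -/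

import Mathlib

/-- `ω = (ω₁, ω₂)` is irrational: `ω₁m₁ + ω₂m₂ ≠ 0` for every nonzero `(m₁, m₂) ∈ ℤ²`. -/
def IsIrrationalPair (ω : ℝ × ℝ) : Prop :=
  ∀ m : ℤ × ℤ, m ≠ 0 → ω.1 * (m.1 : ℝ) + ω.2 * (m.2 : ℝ) ≠ 0

/-- The frequency `λ_k = ω₁(k⁽¹⁾)² + ω₂(k⁽²⁾)²` for `k ∈ ℤ²`. -/
noncomputable def freq (ω : ℝ × ℝ) (k : ℤ × ℤ) : ℝ :=
  ω.1 * (k.1 : ℝ) ^ 2 + ω.2 * (k.2 : ℝ) ^ 2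

/-- Membership in the resonance set `R`. -/
def InRes (ω : ℝ × ℝ) (k₁ k₂ k₃ k₄ : ℤ × ℤ) : Prop :=
  k₁ + k₂ = k₃ + k₄ ∧ freq ω k₁ + freq ω k₂ = freq ω k₃ + freq ω k₄

/-- A resonant 4-tuple is degenerate if `(k₃, k₄) = (k₁, k₂)` or `(k₃, k₄) = (k₂, k₁)`. -/
def Degenerate (k₁ k₂ k₃ k₄ : ℤ × ℤ) : Prop :=
  (k₃ = k₁ ∧ k₄ = k₂) ∨ (k₃ = k₂ ∧ k₄ = k₁)

/-- A nondegenerate element of the resonance set `R`. -/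
def NDRes (ω : ℝ × ℝ) (k₁ k₂ k₃ k₄ : ℤ × ℤ) : Prop :=
  InRes ω k₁ k₂ k₃ k₄ ∧ ¬ Degenerate k₁ k₂ k₃ k₄

/-- Two pairs of integers with equal sums and equal sums of squares agree up to order. -/
theorem eq_and_eq_or_of_add_eq_of_sq_add_sq_eq {x y z w : ℤ} (hadd : x + y = z + w)
    (hsq : x ^ 2 + y ^ 2 = z ^ 2 + w ^ 2) : (z = x ∧ w = y) ∨ (z = y ∧ w = x) := by
  obtain rfl : w = x + y - z := by omega
  have h : (z - x) * (z - y) = 0 := by linarith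
  rcases mul_eq_zero.mp h with h | h
  · left; omega
  · right; omega

/-- For irrational `ω`, the resonance condition on frequencies splits coordinatewise. -/
theorem InRes.sq_add_sq_eq {ω : ℝ × ℝ} (hirr : IsIrrationalPair ω) {k₁ k₂ k₃ k₄ : ℤ × ℤ}
    (h : InRes ω k₁ k₂ k₃ k₄) :
    k₁.1 ^ 2 + k₂.1 ^ 2 = k₃.1 ^ 2 + k₄.1 ^ 2 ∧ k₁.2 ^ 2 + k₂.2 ^ 2 = k₃.2 ^ 2 + k₄.2 ^ 2 := by
  have hm : ((k₁.1 ^ 2 + k₂.1 ^ 2 - k₃.1 ^ 2 - k₄.1 ^ 2,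
      k₁.2 ^ 2 + k₂.2 ^ 2 - k₃.2 ^ 2 - k₄.2 ^ 2) : ℤ × ℤ) = 0 := by
    by_contra hne
    refine hirr _ hne ?_
    have h2 := h.2
    simp only [freq] at h2
    push_cast
    linarith
  rw [Prod.mk_eq_zero] at hm
  omega

/-- For irrational `ω`, nondegenerate resonances are axis-parallel rectangles: `k₃, k₄` are the
two corners opposite to the diagonal `k₁, k₂`. -/
theorem NDRes.eq_corners {ω : ℝ × ℝ} (hirr : IsIrrationalPair ω) {k₁ k₂ k₃ k₄ : ℤ × ℤ}
    (h : NDRes ω k₁ k₂ k₃ k₄) :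
    (k₃ = (k₁.1, k₂.2) ∧ k₄ = (k₂.1, k₁.2)) ∨ (k₃ = (k₂.1, k₁.2) ∧ k₄ = (k₁.1, k₂.2)) := by
  obtain ⟨hres, hnd⟩ := h
  obtain ⟨hsq₁, hsq₂⟩ := hres.sq_add_sq_eq hirr
  have hx := eq_and_eq_or_of_add_eq_of_sq_add_sq_eq (congrArg Prod.fst hres.1) hsq₁
  have hy := eq_and_eq_or_of_add_eq_of_sq_add_sq_eq (congrArg Prod.snd hres.1) hsq₂
  simp only [Degenerate, Prod.ext_iff] at hnd ⊢
  tauto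

theorem NDRes.swap_left {ω : ℝ × ℝ} {k₁ k₂ k₃ k₄ : ℤ × ℤ} (h : NDRes ω k₁ k₂ k₃ k₄) :
    NDRes ω k₂ k₁ k₃ k₄ := by
  obtain ⟨⟨hadd, hfreq⟩, hnd⟩ := h
  refine ⟨⟨by rw [add_comm, hadd], by rw [add_comm, hfreq]⟩, ?_⟩
  rintro (h | h)
  exacts [hnd (Or.inr h), hnd (Or.inl h)]

/-- If `Λ₁ = {(aᵢ, bᵢ)}` (an injective enumeration) and `Λ₂` satisfy the existence and
uniqueness of spouse/children and of sibling/parents with respect to nondegenerate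
resonances, then `Λ₂ = {(aᵢ, b_{σ(i)})}` for some bijection `σ`. -/
theorem stmt_8 {I : Type*} [Fintype I] (ω : ℝ × ℝ) (hω1 : 0 < ω.1) (hω2 : 0 < ω.2)
    (hirr : IsIrrationalPair ω) (a b : I → ℤ)
    (hinj : Function.Injective (fun i => ((a i, b i) : ℤ × ℤ)))
    (Λ₂ : Set (ℤ × ℤ)) (hfin : Λ₂.Finite)
    (Λ₁ : Set (ℤ × ℤ)) (hΛ₁ : Λ₁ = Set.range (fun i => ((a i, b i) : ℤ × ℤ)))
    (hchild : ∀ n₁ ∈ Λ₁, ∃ n₂ ∈ Λ₁, ∃ n₃ ∈ Λ₂, ∃ n₄ ∈ Λ₂,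
      NDRes ω n₁ n₂ n₃ n₄ ∧
      ∀ n₂' ∈ Λ₁, ∀ n₃' ∈ Λ₂, ∀ n₄' ∈ Λ₂, NDRes ω n₁ n₂' n₃' n₄' →
        n₂' = n₂ ∧ ({n₃', n₄'} : Set (ℤ × ℤ)) = {n₃, n₄})
    (hparent : ∀ n₃ ∈ Λ₂, ∃ n₄ ∈ Λ₂, ∃ n₁ ∈ Λ₁, ∃ n₂ ∈ Λ₁,
      NDRes ω n₁ n₂ n₃ n₄ ∧
      ∀ n₄' ∈ Λ₂, ∀ n₁' ∈ Λ₁, ∀ n₂' ∈ Λ₁, NDRes ω n₁' n₂' n₃ n₄' →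
        n₄' = n₄ ∧ ({n₁', n₂'} : Set (ℤ × ℤ)) = {n₁, n₂}) :
    ∃ σ : Equiv.Perm I, Λ₂ = Set.range (fun i => ((a i, b (σ i)) : ℤ × ℤ)) := by
  subst hΛ₁
  simp only [Set.forall_mem_range, Set.exists_range_iff] at hchild hparent
  choose spouse c₃ hc₃ c₄ hc₄ hres huniq using hchild
  have spouse_eq {i j : I} {k₃ k₄ : ℤ × ℤ} (h₃ : k₃ ∈ Λ₂) (h₄ : k₄ ∈ Λ₂)
      (h : NDRes ω (a i, b i) (a j, b j) k₃ k₄) : spouse i = j :=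
    (hinj (huniq i j k₃ h₃ k₄ h₄ h).1).symm
  have hinv : Function.Involutive spouse := fun i =>
    spouse_eq (hc₃ i) (hc₄ i) (hres i).swap_left
  refine ⟨hinv.toPerm, Set.Subset.antisymm (fun n hn => ?_) ?_⟩
  · obtain ⟨n₄, hn₄, i, j, h, -⟩ := hparent n hn
    obtain ⟨rfl, -⟩ | ⟨rfl, -⟩ := h.eq_corners hirr
    · exact ⟨i, by simp [spouse_eq hn hn₄ h]⟩
    · exact ⟨j, by simp [spouse_eq hn hn₄ h.swap_left]⟩
  · rintro _ ⟨i, rfl⟩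
    obtain ⟨h, -⟩ | ⟨-, h⟩ := (hres i).eq_corners hirr
    · simpa [← h] using hc₃ i
    · simpa [← h] using hc₄ i
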